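/- Let G be a finite connected loopless graph of genus g = |E(G)| − |V(G)| + 1, let q ∈ V(G), and let σ* be an acyclic cocycle signature of G. Then BD_{I_G^{σ*}}(G) is a classical stability condition: there exists a generic numerical polarization φ of degree g on G such that for every spanning tree T and every edge e ∈ T, writing W_e for the vertex set of either component of T∖e, one has Σ_{v∈W_e} I_G^{σ*}(T)(v) = n(φ)_{W_e} − g(G[W_e]), where g(G[W_e]) = |E(G[W_e])| − |W_e| + 1. -/

import Mathlib

open Finset

open scoped Classical

section MultiGraph

variable {V E : Type*} [Fintype V] [Fintype E] [DecidableEq V] [DecidableEq E]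

/-- Degree of a vertex in the loopless multigraph with edge-endpoint maps `s`, `t`. -/
def deg (s t : E → V) (v : V) : ℕ :=
  (Finset.univ.filter fun e => s e = v).card + (Finset.univ.filter fun e => t e = v).card

/-- Edges with both endpoints in `W` (edge set of the induced subgraph `G[W]`). -/
def inEdges (s t : E → V) (W : Finset V) : Finset E :=
  Finset.univ.filter fun e => s e ∈ W ∧ t e ∈ W

/-- Edges with exactly one endpoint in `W` (the cut `E(W, Wᶜ)`). -/
def cutEdges (s t : E → V) (W : Finset V) : Finset E :=
  Finset.univ.filter fun e => (s e ∈ W ∧ t e ∉ W) ∨ (s e ∉ W ∧ t e ∈ W)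

/-- Edges with one endpoint in `A` and the other in `B`. -/
def betweenEdges (s t : E → V) (A B : Finset V) : Finset E :=
  Finset.univ.filter fun e => (s e ∈ A ∧ t e ∈ B) ∨ (s e ∈ B ∧ t e ∈ A)

/-- Reachability using only edges in `F`. -/
def Reach (s t : E → V) (F : Finset E) (a b : V) : Prop :=
  Relation.ReflTransGen (fun x y => ∃ e ∈ F, (s e = x ∧ t e = y) ∨ (s e = y ∧ t e = x)) a b

/-- The vertex set `W` is nonempty and connected using the edges in `F`. -/
def ConnOn (s t : E → V) (F : Finset E) (W : Finset V) : Prop :=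
  W.Nonempty ∧ ∀ a ∈ W, ∀ b ∈ W, Reach s t F a b

/-- The induced subgraph `G[W]` is connected. -/
def IndConn (s t : E → V) (W : Finset V) : Prop :=
  ConnOn s t (inEdges s t W) W

/-- `W` is biconnected: both `G[W]` and `G[Wᶜ]` are connected (hence `W` is nontrivial). -/
def Biconn (s t : E → V) (W : Finset V) : Prop :=
  IndConn s t W ∧ IndConn s t Wᶜ

/-- The genus `g(G) = |E| - |V| + 1` of the multigraph. -/
def genus (_s _t : E → V) : ℤ := (Fintype.card E : ℤ) - Fintype.card V + 1

/-- The genus `g(G[W]) = |E(G[W])| - |W| + 1` of the induced subgraph on `W`. -/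
def indGenus (s t : E → V) (W : Finset V) : ℤ := ((inEdges s t W).card : ℤ) - W.card + 1

/-- The polarization `φ_pcan(v) = ((|E|+1)/(2|E|))·deg(v) − 1`. -/
noncomputable def pcan (s t : E → V) (v : V) : ℝ :=
  ((Fintype.card E + 1 : ℝ) / (2 * Fintype.card E)) * deg s t v - 1

/-- A spanning tree: a connected spanning subgraph with `|V| - 1` edges. -/
def IsSpanningTree (s t : E → V) (T : Finset E) : Prop :=
  ConnOn s t T Finset.univ ∧ T.card + 1 = Fintype.card V

/-- For `e ∈ T`, the vertex set of the component of `T ∖ e` containing `s e`. -/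
noncomputable def treeSide (s t : E → V) (T : Finset E) (e : E) : Finset V :=
  Finset.univ.filter fun v => Reach s t (T.erase e) (s e) v

/-- The head of the edge `e` under the orientation `o`
(`o e = true` means `e` is directed from `s e` to `t e`, i.e. as in the reference orientation). -/
def ohead (s t : E → V) (o : E → Bool) (e : E) : V := if o e then t e else s e

/-- A cocycle signature, encoded as a choice, for each `W`, of a coherent orientation of the
cut `E(W,Wᶜ)`: `σ W = true` means all edges of the cut are directed towards `W`. -/
def IsSignature (s t : E → V) (σ : Finset V → Bool) : Prop :=
  ∀ W : Finset V, Biconn s t W → σ Wᶜ = ! σ W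

/-- The orientation `T⃗*_σ` of a spanning tree `T`: each `e ∈ T` is directed as it is in
`σ(C*(T,e))`, where `C*(T,e)` is the fundamental cocycle `E(W_e, W_eᶜ)` with `W_e ∋ s e`. -/
noncomputable def sigmaOrient (s t : E → V) (σ : Finset V → Bool) (T : Finset E) : E → Bool :=
  fun e => ! σ (treeSide s t T e)

/-- `σ` is triangulating: for every spanning tree `T`, every cocycle `E(W,Wᶜ)` (for biconnected
`W`) and every coherent orientation of it (towards `W` iff `b`), if every edge of the cocycle
lying in `T` is directed in `σ(C*(T,e))` the same way as in that coherent orientation, then `σ`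
assigns that orientation to the cocycle. -/
noncomputable def Triangulating (s t : E → V) (σ : Finset V → Bool) : Prop :=
  ∀ T : Finset E, IsSpanningTree s t T → ∀ W : Finset V, Biconn s t W → ∀ b : Bool,
    (∀ e ∈ cutEdges s t W ∩ T, (ohead s t (sigmaOrient s t σ T) e ∈ W ↔ b = true)) →
    σ W = b

/-- The vector in `ℝ^E` associated to the coherently oriented cocycle `σ(E(W,Wᶜ))`:
`+1` on edges directed as in the reference orientation, `-1` on edges directed oppositely,
`0` off the cocycle. -/
noncomputable def cocycVec (s t : E → V) (σ : Finset V → Bool) (W : Finset V) : E → ℝ :=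
  fun e =>
    if s e ∈ W ∧ t e ∉ W then (if σ W then -1 else 1)
    else if s e ∉ W ∧ t e ∈ W then (if σ W then 1 else -1)
    else 0

/-- `σ` is acyclic: the only nonnegative reals `a_W`, supported on the (biconnected) cocycles,
with `Σ_W a_W · σ(E(W,Wᶜ)) = 0` in `ℝ^E` are all zero. -/
def AcyclicSig (s t : E → V) (σ : Finset V → Bool) : Prop :=
  ∀ a : Finset V → ℝ, (∀ W, 0 ≤ a W) → (∀ W, ¬ Biconn s t W → a W = 0) →
    (∑ W : Finset V, a W • cocycVec s t σ W) = 0 → ∀ W, a W = 0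

/-- The degree-zero divisor `I_G^σ(T)(v) = indeg_{T⃗*_σ}(v) − 1 + [v = q]`. -/
noncomputable def IG (s t : E → V) (σ : Finset V → Bool) (q : V) (T : Finset E) : V → ℤ :=
  fun v => ((T.filter fun e => ohead s t (sigmaOrient s t σ T) e = v).card : ℤ) - 1
    + (if v = q then 1 else 0)

/-- The break divisor `D(T, O_E)`: its value at `v` is the number of edges outside `T`
whose head under the orientation `o` is `v`. -/
def breakDiv (s t : E → V) (T : Finset E) (o : E → Bool) : V → ℤ :=
  fun v => ((Finset.univ.filter fun e => e ∉ T ∧ ohead s t o e = v).card : ℤ)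

/-- The set of generalized break divisors `BD_{I_G^σ}(G)`. -/
noncomputable def BDset (s t : E → V) (σ : Finset V → Bool) (q : V) : Set (V → ℤ) :=
  { D | ∃ T : Finset E, ∃ o : E → Bool, IsSpanningTree s t T ∧
      D = fun v => breakDiv s t T o v + IG s t σ q T v }

/-- The graph Laplacian acting on `ℤ^V`. -/
def lap (s t : E → V) (f : V → ℤ) : V → ℤ :=
  fun v => ∑ e : E, ((if s e = v then 1 else 0) - (if t e = v then 1 else 0)) * (f (s e) - f (t e))

/-- Linear (chip-firing) equivalence of divisors. -/
def LinEquiv (s t : E → V) (D D' : V → ℤ) : Prop :=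
  ∃ f : V → ℤ, ∀ v, D v - D' v = lap s t f v

/-- A numerical polarization `φ` is generic if `φ_W − |E(W,Wᶜ)|/2 ∉ ℤ` for every
nontrivial biconnected `W`. -/
def Generic (s t : E → V) (φ : V → ℝ) : Prop :=
  ∀ W : Finset V, Biconn s t W →
    ∀ n : ℤ, (∑ v ∈ W, φ v) - (cutEdges s t W).card / 2 ≠ (n : ℝ)

/-- `n(φ)_W = ⌈φ_W − |E(W,Wᶜ)|/2⌉`. -/
noncomputable def nphi (s t : E → V) (φ : V → ℝ) (W : Finset V) : ℤ :=
  ⌈(∑ v ∈ W, φ v) - (cutEdges s t W).card / 2⌉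

end MultiGraph

/-- **Gordan's theorem**: finitely many vectors without a nontrivial nonnegative relation lie in a
common open half-space. -/
theorem exists_dotProduct_pos_of_no_nonneg_relation {ι E : Type*} [Fintype ι] [Fintype E]
    (x : ι → E → ℝ)
    (hx : ∀ a : ι → ℝ, (∀ i, 0 ≤ a i) → ∑ i, a i • x i = 0 → ∀ i, a i = 0) :
    ∃ w : E → ℝ, ∀ i, 0 < ∑ e, w e * x i e := by
  let L : (ι → ℝ) →ₗ[ℝ] (E → ℝ) := Fintype.linearCombination ℝ x
  have hL : ∀ a, L a = ∑ i, a i • x i := fun a => Fintype.linearCombination_apply ℝ x a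
  have hconv : Convex ℝ (L '' stdSimplex ℝ ι) := (convex_stdSimplex ℝ ι).linear_image L
  have hclosed : IsClosed (L '' stdSimplex ℝ ι) :=
    ((isCompact_stdSimplex ℝ ι).image L.continuous_of_finiteDimensional).isClosed
  have hzero : (0 : E → ℝ) ∉ L '' stdSimplex ℝ ι := by
    rintro ⟨a, ⟨ha, hsum⟩, ha0⟩
    have h := hx a ha (by rw [← hL, ha0])
    simp [h] at hsum
  obtain ⟨f, u, hu, hf⟩ := geometric_hahn_banach_point_closed hconv hclosed hzero
  rw [map_zero] at hu
  refine ⟨fun e => f (Pi.single e 1), fun i => ?_⟩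
  have hmem : x i ∈ L '' stdSimplex ℝ ι :=
    ⟨Pi.single i 1, single_mem_stdSimplex ℝ i, by simp [L]⟩
  have hfx : f (x i) = ∑ e, f (Pi.single e 1) * x i e := by
    conv_lhs => rw [pi_eq_sum_univ' (x i), map_sum]
    refine Finset.sum_congr rfl fun e _ => ?_
    rw [map_smul, smul_eq_mul, mul_comm]
  rw [← hfx]
  exact hu.trans (hf _ hmem)

theorem Reach.symm {V E : Type*} {s t : E → V} {F : Finset E} {a b : V} (h : Reach s t F a b) :
    Reach s t F b a := by
  induction h with
  | refl => exact .refl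
  | tail _ hbc ih =>
    obtain ⟨e, he, h⟩ := hbc
    exact .head ⟨e, he, h.symm⟩ ih

theorem Reach.edge {V E : Type*} {s t : E → V} {F : Finset E} {e : E} (he : e ∈ F) :
    Reach s t F (s e) (t e) :=
  .single ⟨e, he, .inl ⟨rfl, rfl⟩⟩

/-- A property that every edge of `F` transports in both directions is constant along
`F`-paths. -/
theorem Reach.induction {V E : Type*} {s t : E → V} {F : Finset E} {a b : V} (h : Reach s t F a b)
    {P : V → Prop} (hP : ∀ e ∈ F, (P (s e) ↔ P (t e))) (ha : P a) : P b := by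
  induction h with
  | refl => exact ha
  | tail _ hbc ih =>
    obtain ⟨e, he, ⟨rfl, rfl⟩ | ⟨rfl, rfl⟩⟩ := hbc
    · exact (hP e he).1 ih
    · exact (hP e he).2 ih

theorem Reach.mono {V E : Type*} {s t : E → V} {F F' : Finset E} (hF : F ⊆ F') {a b : V}
    (h : Reach s t F a b) : Reach s t F' a b :=
  Relation.ReflTransGen.mono (fun _ _ ⟨e, he, h⟩ => ⟨e, hF he, h⟩) _ _ h

/-- If no edge of `F` leaves `W`, then `F`-paths starting in `W` use only edges inside `W`. -/
theorem Reach.restrict {V E : Type*} [DecidableEq V] {s t : E → V} {F : Finset E} {W : Finset V} {a b : V}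
    (h : Reach s t F a b) (hF : ∀ e ∈ F, (s e ∈ W ↔ t e ∈ W)) (ha : a ∈ W) :
    Reach s t (F.filter fun e => s e ∈ W ∧ t e ∈ W) a b := by
  have key : b ∈ W ∧ Reach s t (F.filter fun e => s e ∈ W ∧ t e ∈ W) a b := by
    refine h.induction
      (P := fun v => v ∈ W ∧ Reach s t (F.filter fun e => s e ∈ W ∧ t e ∈ W) a v)
      (fun e he => ⟨fun hs => ?_, fun ht => ?_⟩) ⟨ha, .refl⟩
    · have htW := (hF e he).1 hs.1
      exact ⟨htW, hs.2.trans (Reach.edge (by simp [he, hs.1, htW]))⟩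
    · have hsW := (hF e he).2 ht.1
      exact ⟨hsW, ht.2.trans (Reach.edge (by simp [he, ht.1, hsW])).symm⟩
  exact key.2

section Cuts

variable {V E : Type*} [Fintype V] [Fintype E] [DecidableEq V] [DecidableEq E]

theorem card_reach_le (s t : E → V) (F : Finset E) (A : Finset V) :
    (Finset.univ.filter fun v => ∃ a ∈ A, Reach s t F a v).card ≤ F.card + A.card := by
  induction F using Finset.induction_on generalizing A with
  | empty =>
    rw [Finset.card_empty, zero_add]
    refine Finset.card_le_card fun v hv => ?_
    obtain ⟨a, ha, h⟩ := (Finset.mem_filter.1 hv).2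
    exact h.induction (P := (· ∈ A)) (by simp) ha
  | insert e F he ih =>
    rw [Finset.card_insert_of_notMem he]
    have step : ∀ B : Finset V, A ⊆ B →
        ((∃ a ∈ B, Reach s t F a (s e)) ↔ ∃ a ∈ B, Reach s t F a (t e)) →
        (Finset.univ.filter fun v => ∃ a ∈ A, Reach s t (insert e F) a v).card
          ≤ F.card + B.card := by
      intro B hAB hB
      refine (Finset.card_le_card fun v hv => ?_).trans (ih B)
      obtain ⟨a, ha, h⟩ := (Finset.mem_filter.1 hv).2
      refine Finset.mem_filter.2 ⟨Finset.mem_univ _, ?_⟩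
      refine h.induction (P := fun v => ∃ b ∈ B, Reach s t F b v) (fun e' he' => ?_)
        ⟨a, hAB ha, .refl⟩
      obtain rfl | he' := Finset.mem_insert.1 he'
      · exact hB
      · exact ⟨fun ⟨b, hb, h⟩ => ⟨b, hb, h.trans (Reach.edge he')⟩,
          fun ⟨b, hb, h⟩ => ⟨b, hb, h.trans (Reach.edge he').symm⟩⟩
    have stepInsert : ∀ x, ((∃ a ∈ insert x A, Reach s t F a (s e)) ∧
          ∃ a ∈ insert x A, Reach s t F a (t e)) →
        (Finset.univ.filter fun v => ∃ a ∈ A, Reach s t (insert e F) a v).card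
          ≤ F.card + 1 + A.card := fun x hx => by
      have h1 := step (insert x A) (Finset.subset_insert _ _) ⟨fun _ => hx.2, fun _ => hx.1⟩
      have h2 := Finset.card_insert_le x A
      omega
    by_cases hs : ∃ a ∈ A, Reach s t F a (s e)
    · obtain ⟨a, ha, h⟩ := hs
      exact stepInsert (t e) ⟨⟨a, Finset.mem_insert_of_mem ha, h⟩,
        ⟨t e, Finset.mem_insert_self _ _, .refl⟩⟩
    by_cases ht : ∃ a ∈ A, Reach s t F a (t e)
    · obtain ⟨a, ha, h⟩ := ht
      exact stepInsert (s e) ⟨⟨s e, Finset.mem_insert_self _ _, .refl⟩,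
        ⟨a, Finset.mem_insert_of_mem ha, h⟩⟩
    have := step A subset_rfl ⟨fun h => (hs h).elim, fun h => (ht h).elim⟩
    omega

/-- A connected graph has at most one more vertex than edges. -/
theorem ConnOn.card_le {s t : E → V} {F : Finset E} {W : Finset V} (h : ConnOn s t F W) :
    W.card ≤ F.card + 1 := by
  obtain ⟨⟨a, ha⟩, h⟩ := h
  refine (Finset.card_le_card fun v hv => ?_).trans (card_reach_le s t F {a})
  simpa using h a ha v hv

theorem ConnOn.indConn {s t : E → V} {T : Finset E} {W : Finset V}
    (h : ConnOn s t (T.filter fun e => s e ∈ W ∧ t e ∈ W) W) : IndConn s t W :=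
  ⟨h.1, fun a ha b hb => (h.2 a ha b hb).mono fun e he =>
    Finset.mem_filter.2 ⟨Finset.mem_univ e, (Finset.mem_filter.1 he).2⟩⟩

section Tree

variable {s t : E → V} {T : Finset E} {e : E}

theorem mem_treeSide {v : V} : v ∈ treeSide s t T e ↔ Reach s t (T.erase e) (s e) v := by
  simp [treeSide]

theorem left_mem_treeSide : s e ∈ treeSide s t T e := mem_treeSide.2 .refl

theorem treeSide_uncrossed {e' : E} (he' : e' ∈ T.erase e) :
    s e' ∈ treeSide s t T e ↔ t e' ∈ treeSide s t T e := by
  simp only [mem_treeSide]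
  exact ⟨fun h => h.trans (Reach.edge he'), fun h => h.trans (Reach.edge he').symm⟩

theorem IsSpanningTree.reach_erase (hT : IsSpanningTree s t T) (v : V) :
    Reach s t (T.erase e) (s e) v ∨ Reach s t (T.erase e) (t e) v := by
  refine (hT.1.2 (s e) (Finset.mem_univ _) v (Finset.mem_univ _)).induction
    (P := fun v => Reach s t (T.erase e) (s e) v ∨ Reach s t (T.erase e) (t e) v)
    (fun e' he' => ?_) (.inl .refl)
  by_cases h : e' = e
  · subst h
    exact ⟨fun _ => .inr .refl, fun _ => .inl .refl⟩
  · have hr : Reach s t (T.erase e) (s e') (t e') := Reach.edge (Finset.mem_erase.2 ⟨h, he'⟩)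
    exact ⟨Or.imp (·.trans hr) (·.trans hr), Or.imp (·.trans hr.symm) (·.trans hr.symm)⟩

theorem IsSpanningTree.right_notMem_treeSide (hT : IsSpanningTree s t T) (he : e ∈ T) :
    t e ∉ treeSide s t T e := by
  intro h
  have hall : ∀ v, Reach s t (T.erase e) (s e) v := fun v =>
    (hT.reach_erase v).elim id fun hv => (mem_treeSide.1 h).trans hv
  have hc : ConnOn s t (T.erase e) Finset.univ :=
    ⟨⟨s e, Finset.mem_univ _⟩, fun a _ b _ => (hall a).symm.trans (hall b)⟩
  have h1 := hc.card_le
  have h2 := hT.2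
  have h3 := Finset.card_erase_add_one he
  rw [Finset.card_univ] at h1
  omega

theorem connOn_treeSide :
    ConnOn s t ((T.erase e).filter fun e' => s e' ∈ treeSide s t T e ∧ t e' ∈ treeSide s t T e)
      (treeSide s t T e) :=
  ⟨⟨s e, left_mem_treeSide⟩, fun _ ha _ hb => Reach.restrict
    ((mem_treeSide.1 ha).symm.trans (mem_treeSide.1 hb)) (fun _ he' => treeSide_uncrossed he') ha⟩

theorem IsSpanningTree.connOn_compl_treeSide (hT : IsSpanningTree s t T) (he : e ∈ T) :
    ConnOn s t ((T.erase e).filter fun e' => s e' ∈ (treeSide s t T e)ᶜ ∧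
      t e' ∈ (treeSide s t T e)ᶜ) (treeSide s t T e)ᶜ := by
  have hr : ∀ v ∈ (treeSide s t T e)ᶜ, Reach s t (T.erase e) (t e) v := fun v hv =>
    (hT.reach_erase v).resolve_left fun h => Finset.mem_compl.1 hv (mem_treeSide.2 h)
  refine ⟨⟨t e, Finset.mem_compl.2 (hT.right_notMem_treeSide he)⟩, fun a ha b hb =>
    Reach.restrict ((hr a ha).symm.trans (hr b hb)) (fun e' he' => ?_) ha⟩
  rw [Finset.mem_compl, Finset.mem_compl, treeSide_uncrossed he']

theorem IsSpanningTree.biconn_treeSide (hT : IsSpanningTree s t T) (he : e ∈ T) :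
    Biconn s t (treeSide s t T e) :=
  ⟨connOn_treeSide.indConn, (hT.connOn_compl_treeSide he).indConn⟩

theorem IsSpanningTree.card_inside_treeSide (hT : IsSpanningTree s t T) (he : e ∈ T) :
    ((T.erase e).filter fun e' => s e' ∈ treeSide s t T e ∧ t e' ∈ treeSide s t T e).card + 1
        = (treeSide s t T e).card ∧
      ((T.erase e).filter fun e' => s e' ∈ (treeSide s t T e)ᶜ ∧
        t e' ∈ (treeSide s t T e)ᶜ).card + 1 = (treeSide s t T e)ᶜ.card := by
  have h1 := (connOn_treeSide (s := s) (t := t) (T := T) (e := e)).card_le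
  have h2 := (hT.connOn_compl_treeSide he).card_le
  have h3 := Finset.card_add_card_compl (treeSide s t T e)
  have h4 := hT.2
  have h5 := Finset.card_erase_add_one he
  have h6 : ((T.erase e).filter fun e' => s e' ∈ (treeSide s t T e)ᶜ ∧
        t e' ∈ (treeSide s t T e)ᶜ) =
      (T.erase e).filter fun e' => ¬(s e' ∈ treeSide s t T e ∧ t e' ∈ treeSide s t T e) := by
    refine Finset.filter_congr fun e' he' => ?_
    have := treeSide_uncrossed (s := s) (t := t) he'
    rw [Finset.mem_compl, Finset.mem_compl]
    tauto
  have h7 := Finset.card_filter_add_card_filter_not (s := T.erase e)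
    (fun e' : E => s e' ∈ treeSide s t T e ∧ t e' ∈ treeSide s t T e)
  rw [← h6] at h7
  omega

/-- If `e` is the only edge of `T` crossing `W`, then the edges of `T` with head in `W` are those
inside `W`, together with `e` if it points into `W`. -/
theorem card_filter_ohead_mem (o : E → Bool) (W : Finset V) (he : e ∈ T)
    (hT : ∀ e' ∈ T.erase e, (s e' ∈ W ↔ t e' ∈ W)) :
    (T.filter fun e' => ohead s t o e' ∈ W).card =
      ((T.erase e).filter fun e' => s e' ∈ W ∧ t e' ∈ W).card +
        if ohead s t o e ∈ W then 1 else 0 := by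
  have h : (T.erase e).filter (fun e' => ohead s t o e' ∈ W) =
      (T.erase e).filter fun e' => s e' ∈ W ∧ t e' ∈ W := by
    refine Finset.filter_congr fun e' he' => ?_
    have := hT e' he'
    unfold ohead
    split_ifs <;> tauto
  rw [← h]
  conv_lhs => rw [← Finset.insert_erase he, Finset.filter_insert]
  split_ifs
  · exact Finset.card_insert_of_notMem (by simp)
  · simp

theorem sum_IG (σ : Finset V → Bool) (q : V) (W : Finset V) :
    ∑ v ∈ W, IG s t σ q T v =
      ((T.filter fun e => ohead s t (sigmaOrient s t σ T) e ∈ W).card : ℤ) - W.card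
        + if q ∈ W then 1 else 0 := by
  have h : ((T.filter fun e => ohead s t (sigmaOrient s t σ T) e ∈ W).card : ℤ) =
      ∑ v ∈ W, ((T.filter fun e => ohead s t (sigmaOrient s t σ T) e = v).card : ℤ) := by
    simp only [Finset.card_filter, Nat.cast_sum]
    rw [Finset.sum_comm]
    refine Finset.sum_congr rfl fun e _ => ?_
    simp
  simp only [IG, Finset.sum_add_distrib, Finset.sum_sub_distrib, h]
  simp

theorem IsSpanningTree.sum_IG_eq (hT : IsSpanningTree s t T) (he : e ∈ T)
    {σ : Finset V → Bool} (hsig : IsSignature s t σ) (q : V) {W : Finset V}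
    (hW : W = treeSide s t T e ∨ W = (treeSide s t T e)ᶜ) :
    ∑ v ∈ W, IG s t σ q T v =
      (if σ W then 1 else 0) + (if q ∈ W then 1 else 0) - 1 := by
  have hs : s e ∈ treeSide s t T e := left_mem_treeSide
  have ht := hT.right_notMem_treeSide he
  have hcard := hT.card_inside_treeSide he
  have hcompl := hsig _ (hT.biconn_treeSide he)
  have hhead : ohead s t (sigmaOrient s t σ T) e ∈ treeSide s t T e ↔
      σ (treeSide s t T e) = true := by
    unfold ohead sigmaOrient
    cases σ (treeSide s t T e) <;> simp [hs, ht]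
  rw [sum_IG]
  obtain rfl | rfl := hW
  · rw [card_filter_ohead_mem _ _ he fun e' he' => treeSide_uncrossed he', ← hcard.1]
    simp only [hhead]
    push_cast
    ring
  · rw [card_filter_ohead_mem _ _ he fun e' he' => by
      rw [Finset.mem_compl, Finset.mem_compl, treeSide_uncrossed he'], ← hcard.2]
    have : ohead s t (sigmaOrient s t σ T) e ∈ (treeSide s t T e)ᶜ ↔
        σ (treeSide s t T e)ᶜ = true := by
      rw [Finset.mem_compl, hhead, hcompl]
      simp
    simp only [this]
    push_cast
    ring

theorem IsSpanningTree.biconn_of_side (hT : IsSpanningTree s t T) (he : e ∈ T) {W : Finset V}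
    (hW : W = treeSide s t T e ∨ W = (treeSide s t T e)ᶜ) : Biconn s t W := by
  have h := hT.biconn_treeSide he
  obtain rfl | rfl := hW
  · exact h
  · exact ⟨h.2, by rw [compl_compl]; exact h.1⟩

end Tree

theorem sum_deg (s t : E → V) (W : Finset V) :
    ∑ v ∈ W, deg s t v = 2 * (inEdges s t W).card + (cutEdges s t W).card := by
  have h : ∀ r : E → V, ∑ v ∈ W, (Finset.univ.filter fun e => r e = v).card =
      ∑ e, if r e ∈ W then 1 else 0 := fun r => by
    simp only [Finset.card_filter]
    rw [Finset.sum_comm]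
    refine Finset.sum_congr rfl fun e _ => ?_
    simp
  simp only [deg, Finset.sum_add_distrib, h]
  simp only [inEdges, cutEdges, Finset.card_filter, Finset.mul_sum]
  rw [← Finset.sum_add_distrib, ← Finset.sum_add_distrib]
  refine Finset.sum_congr rfl fun e _ => ?_
  by_cases hs : s e ∈ W <;> by_cases ht : t e ∈ W <;> simp [hs, ht]

/-- The net flow of `w` into the vertex `v`. -/
noncomputable def inflow (s t : E → V) (w : E → ℝ) (v : V) : ℝ :=
  ∑ e, w e * ((if t e = v then 1 else 0) - if s e = v then 1 else 0)

theorem sum_inflow (s t : E → V) (w : E → ℝ) (W : Finset V) :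
    ∑ v ∈ W, inflow s t w v =
      ∑ e, w e * ((if t e ∈ W then 1 else 0) - if s e ∈ W then 1 else 0) := by
  unfold inflow
  rw [Finset.sum_comm]
  refine Finset.sum_congr rfl fun e _ => ?_
  rw [← Finset.mul_sum, Finset.sum_sub_distrib]
  simp

theorem abs_sum_inflow_le (s t : E → V) (w : E → ℝ) (W : Finset V) :
    |∑ v ∈ W, inflow s t w v| ≤ ∑ e, |w e| := by
  rw [sum_inflow]
  refine (Finset.abs_sum_le_sum_abs _ _).trans (Finset.sum_le_sum fun e _ => ?_)
  split_ifs <;> simp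

theorem dotProduct_cocycVec (s t : E → V) (σ : Finset V → Bool) (w : E → ℝ) (W : Finset V) :
    ∑ e, w e * cocycVec s t σ W e =
      (if σ W then 1 else -1) * ∑ v ∈ W, inflow s t w v := by
  rw [sum_inflow, Finset.mul_sum]
  refine Finset.sum_congr rfl fun e _ => ?_
  unfold cocycVec
  by_cases hs : s e ∈ W <;> by_cases ht : t e ∈ W <;> cases σ W <;> simp [hs, ht]

/-- An acyclic signature is induced by a flow `w`, which may be taken arbitrarily small. -/
theorem AcyclicSig.exists_inflow {s t : E → V} {σ : Finset V → Bool} (h : AcyclicSig s t σ) :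
    ∃ w : E → ℝ, (∑ e, |w e| < 1) ∧ ∀ W, Biconn s t W →
      0 < (if σ W then 1 else -1) * ∑ v ∈ W, inflow s t w v := by
  obtain ⟨w, hw⟩ := exists_dotProduct_pos_of_no_nonneg_relation
    (fun W : {W // Biconn s t W} => cocycVec s t σ W) (by
      intro a ha hsum W
      have := h (fun W => if hW : Biconn s t W then a ⟨W, hW⟩ else 0)
        (fun W => by split_ifs <;> simp [ha]) (fun W hW => dif_neg hW) (by
          rw [← hsum]
          refine (Fintype.sum_of_injective Subtype.val Subtype.val_injective _ _
            (fun W hW => ?_) fun W => ?_).symm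
          · rw [dif_neg fun h => hW ⟨⟨W, h⟩, rfl⟩, zero_smul]
          · rw [dif_pos W.2]) W
      simpa [W.2] using this)
  have hpos : 0 < 1 + ∑ e, |w e| :=
    add_pos_of_pos_of_nonneg one_pos (Finset.sum_nonneg fun _ _ => abs_nonneg _)
  refine ⟨fun e => (1 + ∑ e, |w e|)⁻¹ * w e, ?_, fun W hW => ?_⟩
  · simp only [abs_mul, abs_of_pos (inv_pos.2 hpos)]
    rw [← Finset.mul_sum, inv_mul_lt_one₀ hpos]
    linarith
  · rw [← dotProduct_cocycVec]
    simp only [mul_assoc]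
    rw [← Finset.mul_sum]
    exact mul_pos (inv_pos.2 hpos) (hw ⟨W, hW⟩)

/-- The polarization attached to a flow `w` and a base vertex `q`. -/
noncomputable def flowPol (s t : E → V) (q : V) (w : E → ℝ) (v : V) : ℝ :=
  deg s t v / 2 - 1 + (if v = q then 1 else 0) + inflow s t w v

theorem sum_flowPol (s t : E → V) (q : V) (w : E → ℝ) (W : Finset V) :
    ∑ v ∈ W, flowPol s t q w v - (cutEdges s t W).card / 2 =
      (((inEdges s t W).card - W.card + if q ∈ W then 1 else 0 : ℤ) : ℝ) +
        ∑ v ∈ W, inflow s t w v := by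
  have h := congrArg (Nat.cast : ℕ → ℝ) (sum_deg s t W)
  push_cast at h
  simp only [flowPol, Finset.sum_add_distrib, Finset.sum_sub_distrib, ← Finset.sum_div, h]
  simp
  ring

end Cuts


section Statements

variable {V E : Type*} [Fintype V] [Fintype E] [DecidableEq V] [DecidableEq E]

/-- For an acyclic cocycle signature `σ*` and `q ∈ V(G)`,
`BD_{I_G^{σ*}}(G)` is a classical stability condition: there is a generic numerical
polarization `φ` of degree `g` such that for every spanning tree `T` and `e ∈ T`, writing
`W_e` for the vertex set of either component of `T∖e`,
`Σ_{v∈W_e} I_G^{σ*}(T)(v) = n(φ)_{W_e} − g(G[W_e])`. -/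
theorem stmt_10 (s t : E → V) (hloop : ∀ e, s e ≠ t e)
    (hconn : ConnOn s t Finset.univ Finset.univ)
    (q : V) (σ : Finset V → Bool) (hsig : IsSignature s t σ) (hacy : AcyclicSig s t σ) :
    ∃ φ : V → ℝ, (∑ v : V, φ v) = (Fintype.card E : ℝ) - Fintype.card V + 1 ∧
      Generic s t φ ∧
      ∀ T : Finset E, IsSpanningTree s t T → ∀ e ∈ T, ∀ W : Finset V,
        (W = treeSide s t T e ∨ W = (treeSide s t T e)ᶜ) →
        (∑ v ∈ W, IG s t σ q T v) = nphi s t φ W - indGenus s t W := by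
  obtain ⟨w, hw, hpos⟩ := hacy.exists_inflow
  have habs : ∀ W, |∑ v ∈ W, inflow s t w v| < 1 := fun W =>
    (abs_sum_inflow_le s t w W).trans_lt hw
  refine ⟨flowPol s t q w, ?_, fun W hW n hn => ?_, fun T hT e he W hW => ?_⟩
  · have h := sum_flowPol s t q w Finset.univ
    have h0 : ∑ v, inflow s t w v = 0 := by simp [sum_inflow]
    simp [h0, inEdges, cutEdges] at h
    linarith
  · have hb := hpos W hW
    have ha := abs_lt.1 (habs W)
    rw [sum_flowPol, ← eq_sub_iff_add_eq', ← Int.cast_sub] at hn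
    rw [hn] at hb ha
    obtain ⟨h1, h2⟩ := ha
    have h1 : -1 < n - ((inEdges s t W).card - W.card + if q ∈ W then 1 else 0 : ℤ) := by
      exact_mod_cast h1
    have h2 : n - ((inEdges s t W).card - W.card + if q ∈ W then 1 else 0 : ℤ) < 1 := by
      exact_mod_cast h2
    rw [show n - ((inEdges s t W).card - W.card + if q ∈ W then 1 else 0 : ℤ) = 0 by omega] at hb
    simp at hb
  · have hb := hpos W (hT.biconn_of_side he hW)
    have ha := abs_lt.1 (habs W)
    have hceil : ⌈∑ v ∈ W, inflow s t w v⌉ = if σ W then 1 else 0 := by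
      rw [Int.ceil_eq_iff]
      split_ifs at hb ⊢ <;> push_cast <;> constructor <;> linarith
    rw [hT.sum_IG_eq he hsig q hW, nphi, sum_flowPol, Int.ceil_intCast_add, hceil, indGenus]
    ring

end Statements
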